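/- arXiv:2309.06570 — 5 statements merged into one kernel-verified Lean document; each statement's English description precedes it below -/
import Mathlib

section
/- Let m and n be integers with 1 < m ≤ n, and let s be a natural number with binary digits s_i. Then Z_m(s mod 2^m) = 2·Z_{m−1}(s mod 2^{m−1}) + (s_0 ⊕ s_1 ⊕ s_2 ⊕ ⋯ ⊕ s_{m−1}), where ⊕ denotes addition modulo 2. -/
/-- The `i`-th binary digit of `s`, as a natural number in `{0,1}`. -/
def bit (s i : ℕ) : ℕ := (s.testBit i).toNat

/-- Bitwise dot product of `s` and `x` modulo 2: `s·x = Σ_i s_i x_i mod 2`.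
(All bits of `s` beyond position `s` vanish, so the range `s+1` covers all terms.) -/
def dot (s x : ℕ) : ℕ := (∑ i ∈ Finset.range (s + 1), bit s i * bit x i) % 2

/-- `Z_m(x) = (1/2) Σ_{k=0}^{2^m-2} |(-1)^{x·(k+1)} - (-1)^{x·k}|`, the number of sign
changes of the vector `((-1)^{x·k})_{k=0}^{2^m-1}`. -/
noncomputable def Z (m x : ℕ) : ℝ :=
  (1/2) * ∑ k ∈ Finset.range (2^m - 1), |(-1:ℝ)^(dot x (k+1)) - (-1:ℝ)^(dot x k)|

/-- The bit `g_k := s_0 ⊕ s_1 ⊕ ⋯ ⊕ s_{n-1-k}` (parity of the `n-k` least significant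
bits of `s`); in particular `g_{n-1} = s_0` and `g_n = 0`. -/
def gbit (n s k : ℕ) : ℕ := (∑ i ∈ Finset.range (n - k), bit s i) % 2

/-- `g(s) := Σ_{k=0}^{n-1} g_k 2^k`. -/
def gFun (n s : ℕ) : ℕ := ∑ k ∈ Finset.range n, gbit n s k * 2^k

/-- `e_n(k,j) := Σ_{r=0}^{n-1} k_{n-1-r} (j_r ⊕ j_{r+1}) mod 2`. -/
def eSeq (n k j : ℕ) : ℕ :=
  (∑ r ∈ Finset.range n, bit k (n-1-r) * ((bit j r + bit j (r+1)) % 2)) % 2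

/-- The sequency-ordered Walsh–Hadamard matrix `H^S_N`, `N = 2^n`, with
`(k,j)` entry `(1/√N)·(-1)^{e_n(k,j)}`. -/
noncomputable def HS (n : ℕ) : Matrix (Fin (2^n)) (Fin (2^n)) ℝ :=
  Matrix.of fun k j => (1 / Real.sqrt (2^n)) * (-1)^(eSeq n k j)

/-- The natural-ordered Walsh–Hadamard matrix `H_N`, `N = 2^n`, with
`(k,j)` entry `(1/√N)·(-1)^{k·j}`. -/
noncomputable def Hnat (n : ℕ) : Matrix (Fin (2^n)) (Fin (2^n)) ℝ :=
  Matrix.of fun k j => (1 / Real.sqrt (2^n)) * (-1)^(dot k j)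

lemma dot_mod_two_pow (L s k : ℕ) :
    dot (s % 2 ^ L) k = (∑ i ∈ Finset.range L, bit s i * bit k i) % 2 := by
  have hbit (i : ℕ) : bit (s % 2 ^ L) i = if i < L then bit s i else 0 := by
    by_cases h : i < L <;> simp [bit, Nat.testBit_mod_two_pow, h]
  have hsum : ∑ i ∈ Finset.range (s % 2 ^ L + 1), bit (s % 2 ^ L) i * bit k i =
      ∑ i ∈ Finset.range L, bit (s % 2 ^ L) i * bit k i := by
    rcases le_total (s % 2 ^ L + 1) L with h | h
    · refine Finset.sum_subset (Finset.range_mono h) fun i _ hi => ?_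
      have hlt : s % 2 ^ L < 2 ^ i :=
        Nat.lt_two_pow_self.trans_le (Nat.pow_le_pow_right two_pos (by simp at hi; omega))
      simp [bit, Nat.testBit_eq_false_of_lt hlt]
    · refine (Finset.sum_subset (Finset.range_mono h) fun i _ hi => ?_).symm
      rw [hbit, if_neg (by simpa using hi), zero_mul]
  rw [dot, hsum]
  congr 1
  refine Finset.sum_congr rfl fun i hi => ?_
  rw [hbit, if_pos (Finset.mem_range.mp hi)]

lemma dot_mod_two_pow_succ_of_lt {M k : ℕ} (s : ℕ) (hk : k < 2 ^ M) :
    dot (s % 2 ^ (M + 1)) k = dot (s % 2 ^ M) k := by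
  rw [dot_mod_two_pow, dot_mod_two_pow, Finset.sum_range_succ]
  simp [bit, Nat.testBit_eq_false_of_lt hk]

lemma dot_mod_two_pow_succ_add {M j : ℕ} (s : ℕ) (hj : j < 2 ^ M) :
    dot (s % 2 ^ (M + 1)) (2 ^ M + j) = (dot (s % 2 ^ M) j + bit s M) % 2 := by
  have hlow : ∑ i ∈ Finset.range M, bit s i * bit (2 ^ M + j) i =
      ∑ i ∈ Finset.range M, bit s i * bit j i :=
    Finset.sum_congr rfl fun i hi => by
      simp [bit, Nat.testBit_two_pow_add_gt (Finset.mem_range.mp hi)]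
  have htop : bit (2 ^ M + j) M = 1 := by
    simp [bit, Nat.testBit_two_pow_add_eq, Nat.testBit_eq_false_of_lt hj]
  rw [dot_mod_two_pow, dot_mod_two_pow, Finset.sum_range_succ, hlow, htop, mul_one,
    Nat.mod_add_mod]

lemma dot_mod_two_pow_two_pow_sub_one (M s : ℕ) :
    dot (s % 2 ^ M) (2 ^ M - 1) = (∑ i ∈ Finset.range M, bit s i) % 2 := by
  rw [dot_mod_two_pow]
  congr 1
  refine Finset.sum_congr rfl fun i hi => ?_
  simp [bit, Nat.testBit_two_pow_sub_one, Finset.mem_range.mp hi]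

lemma abs_neg_one_pow_add_mod_two_sub (a b c : ℕ) :
    |(-1 : ℝ) ^ ((a + c) % 2) - (-1) ^ ((b + c) % 2)| = |(-1 : ℝ) ^ a - (-1) ^ b| := by
  rw [← neg_one_pow_eq_pow_mod_two, ← neg_one_pow_eq_pow_mod_two, pow_add, pow_add, ← sub_mul,
    abs_mul, abs_neg_one_pow, mul_one]

lemma abs_neg_one_pow_sub_neg_one_pow (a b : ℕ) :
    |(-1 : ℝ) ^ a - (-1) ^ b| = 2 * (((b + a) % 2 : ℕ) : ℝ) := by
  rw [neg_one_pow_eq_pow_mod_two (n := a), neg_one_pow_eq_pow_mod_two (n := b), Nat.add_mod]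
  rcases Nat.mod_two_eq_zero_or_one a with ha | ha <;>
    rcases Nat.mod_two_eq_zero_or_one b with hb | hb <;> norm_num [ha, hb]

/-- The sign changes of the row of length `2 ^ (M + 1)` split into those of its two halves
and the one at the middle. -/
lemma Z_succ_mod_two_pow (M s : ℕ) :
    Z (M + 1) (s % 2 ^ (M + 1)) = 2 * Z M (s % 2 ^ M) +
      (((∑ i ∈ Finset.range (M + 1), bit s i) % 2 : ℕ) : ℝ) := by
  have hpos : 0 < 2 ^ M := Nat.two_pow_pos M
  have hlen : 2 ^ (M + 1) - 1 = (2 ^ M - 1) + 1 + (2 ^ M - 1) := by rw [pow_succ]; omega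
  have hmid : 2 ^ M - 1 + 1 = 2 ^ M := by omega
  have hzero : dot (s % 2 ^ M) 0 = 0 := by simp [dot, bit]
  have hfirst : ∀ k ∈ Finset.range (2 ^ M - 1),
      |(-1 : ℝ) ^ dot (s % 2 ^ (M + 1)) (k + 1) - (-1) ^ dot (s % 2 ^ (M + 1)) k| =
      |(-1 : ℝ) ^ dot (s % 2 ^ M) (k + 1) - (-1) ^ dot (s % 2 ^ M) k| := fun k hk => by
    have := Finset.mem_range.mp hk
    rw [dot_mod_two_pow_succ_of_lt s (by omega), dot_mod_two_pow_succ_of_lt s (by omega)]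
  have hsecond : ∀ k ∈ Finset.range (2 ^ M - 1),
      |(-1 : ℝ) ^ dot (s % 2 ^ (M + 1)) (2 ^ M + k + 1) -
        (-1) ^ dot (s % 2 ^ (M + 1)) (2 ^ M + k)| =
      |(-1 : ℝ) ^ dot (s % 2 ^ M) (k + 1) - (-1) ^ dot (s % 2 ^ M) k| := fun k hk => by
    have := Finset.mem_range.mp hk
    rw [add_assoc, dot_mod_two_pow_succ_add s (by omega), dot_mod_two_pow_succ_add s (by omega),
      abs_neg_one_pow_add_mod_two_sub]
  have hjump : |(-1 : ℝ) ^ dot (s % 2 ^ (M + 1)) (2 ^ M) -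
      (-1) ^ dot (s % 2 ^ (M + 1)) (2 ^ M - 1)| =
      2 * (((∑ i ∈ Finset.range (M + 1), bit s i) % 2 : ℕ) : ℝ) := by
    have hN := dot_mod_two_pow_succ_add s hpos
    rw [add_zero, hzero, zero_add] at hN
    rw [hN, dot_mod_two_pow_succ_of_lt s (by omega), dot_mod_two_pow_two_pow_sub_one,
      abs_neg_one_pow_sub_neg_one_pow, ← Nat.add_mod, ← Finset.sum_range_succ]
  rw [Z, Z, hlen, Finset.sum_range_add, Finset.sum_range_succ, Finset.sum_congr rfl hfirst, hmid,
    Finset.sum_congr rfl hsecond, hjump]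
  ring

/-- Lemma 1: for integers `1 < m ≤ n` and a natural number `s`,
`Z_m(s mod 2^m) = 2·Z_{m-1}(s mod 2^{m-1}) + (s_0 ⊕ s_1 ⊕ ⋯ ⊕ s_{m-1})`. -/
theorem stmt_0 (m n : ℕ) (hm : 1 < m) (hmn : m ≤ n) (s : ℕ) :
    Z m (s % 2^m) = 2 * Z (m-1) (s % 2^(m-1)) +
      (((∑ i ∈ Finset.range m, bit s i) % 2 : ℕ) : ℝ) := by
  obtain ⟨M, rfl⟩ : ∃ M, m = M + 1 := ⟨m - 1, by omega⟩
  exact Z_succ_mod_two_pow M s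
end

section
/- Let m > 1 be an integer and let s be a natural number with binary digits s_i. Then (1/2)·|(−1)^{s·2^{m−1}} − (−1)^{s·(2^{m−1}−1)}| = s_0 ⊕ s_1 ⊕ s_2 ⊕ ⋯ ⊕ s_{m−1}, where ⊕ denotes addition modulo 2. -/
theorem bit_eq_zero_of_lt {s i : ℕ} (h : s < i) : bit s i = 0 := by
  simp [bit, Nat.testBit_lt_two_pow (h.trans Nat.lt_two_pow_self)]

/-- The sum in `dot` may be truncated at any `N` beyond which the bits of `x` vanish. -/
theorem dot_eq_of_bit_eq_zero {s x N : ℕ} (hx : ∀ i, N ≤ i → bit x i = 0) :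
    dot s x = (∑ i ∈ Finset.range N, bit s i * bit x i) % 2 := by
  unfold dot
  congr 1
  rcases le_total (s + 1) N with h | h
  · refine Finset.sum_subset (Finset.range_mono h) fun i _ hi => ?_
    rw [bit_eq_zero_of_lt (by simpa using hi), zero_mul]
  · refine (Finset.sum_subset (Finset.range_mono h) fun i _ hi => ?_).symm
    rw [hx i (by simpa using hi), mul_zero]

theorem dot_two_pow (s k : ℕ) : dot s (2 ^ k) = bit s k % 2 := by
  rw [dot_eq_of_bit_eq_zero (N := k + 1), Finset.sum_eq_single k]
  · simp [bit]
  · intro i _ hi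
    simp [bit, hi.symm]
  · simp
  · intro i hi
    simp [bit, (show k ≠ i by omega)]

theorem dot_two_pow_sub_one (s k : ℕ) :
    dot s (2 ^ k - 1) = (∑ i ∈ Finset.range k, bit s i) % 2 := by
  rw [dot_eq_of_bit_eq_zero (N := k)]
  · congr 1
    refine Finset.sum_congr rfl fun i hi => ?_
    simp [bit, Nat.testBit_two_pow_sub_one, Finset.mem_range.mp hi]
  · intro i hi
    simp [bit, Nat.testBit_two_pow_sub_one, hi]

theorem half_abs_neg_one_pow_sub (a b : ℕ) :
    (1 / 2 : ℝ) * |(-1 : ℝ) ^ (a % 2) - (-1 : ℝ) ^ (b % 2)| = (((b + a) % 2 : ℕ) : ℝ) := by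
  rw [Nat.add_mod b a]
  rcases Nat.mod_two_eq_zero_or_one a with ha | ha <;>
    rcases Nat.mod_two_eq_zero_or_one b with hb | hb <;> norm_num [ha, hb]

/-- for `m > 1` and a natural number `s`,
`(1/2)·|(-1)^{s·2^{m-1}} - (-1)^{s·(2^{m-1}-1)}| = s_0 ⊕ s_1 ⊕ ⋯ ⊕ s_{m-1}`. -/
theorem stmt_2 (m : ℕ) (hm : 1 < m) (s : ℕ) :
    (1/2 : ℝ) * |(-1:ℝ)^(dot s (2^(m-1))) - (-1:ℝ)^(dot s (2^(m-1) - 1))| =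
      (((∑ i ∈ Finset.range m, bit s i) % 2 : ℕ) : ℝ) := by
  obtain ⟨k, rfl⟩ : ∃ k, m = k + 1 := ⟨m - 1, by omega⟩
  rw [Nat.add_sub_cancel, dot_two_pow, dot_two_pow_sub_one, half_abs_neg_one_pow_sub,
    Finset.sum_range_succ]
end

section
/- Let m > 1 be an integer and let s be a natural number with binary digits s_i. For every natural number k < 2^{m−1}, one has s·(2^{m−1}+k) ≡ s_{m−1} + s·k (mod 2). Consequently, Σ_{k=2^{m−1}}^{2^m−2} |(−1)^{s·(k+1)} − (−1)^{s·k}| = Σ_{k=0}^{2^{m−1}−2} |(−1)^{s·(k+1)} − (−1)^{s·k}|. -/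
theorem bit_two_pow_add {p k : ℕ} (hk : k < 2 ^ p) (i : ℕ) :
    bit (2 ^ p + k) i = (if i = p then 1 else 0) + bit k i := by
  have h : 2 ^ p + k = 2 ^ p ||| k := by
    simpa using Nat.two_pow_add_eq_or_of_lt hk 1
  unfold bit
  rw [h, Nat.testBit_or, Nat.testBit_two_pow]
  by_cases hi : i = p
  · subst hi
    simp [Nat.testBit_lt_two_pow hk]
  · simp [hi, Ne.symm hi]

theorem dot_two_pow_add_modEq {p k : ℕ} (s : ℕ) (hk : k < 2 ^ p) :
    dot s (2 ^ p + k) ≡ bit s p + dot s k [MOD 2] := by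
  have h : ∑ i ∈ Finset.range (s + 1), bit s i * bit (2 ^ p + k) i =
      bit s p + ∑ i ∈ Finset.range (s + 1), bit s i * bit k i := by
    simp only [bit_two_pow_add hk, mul_add, Finset.sum_add_distrib, mul_ite, mul_one, mul_zero,
      Finset.sum_ite_eq', Finset.mem_range]
    split_ifs with hp
    · rfl
    · have hs : s < 2 ^ p := lt_of_lt_of_le (by omega) (Nat.lt_two_pow_self (n := p)).le
      simp [bit, Nat.testBit_lt_two_pow hs]
  unfold dot
  rw [h]
  exact (Nat.mod_modEq _ _).trans ((Nat.mod_modEq _ _).symm.add_left _)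

theorem neg_one_pow_dot_two_pow_add {p k : ℕ} (s : ℕ) (hk : k < 2 ^ p) :
    (-1 : ℝ) ^ dot s (2 ^ p + k) = (-1) ^ bit s p * (-1) ^ dot s k := by
  rw [← pow_add, neg_one_pow_eq_pow_mod_two, dot_two_pow_add_modEq s hk,
    ← neg_one_pow_eq_pow_mod_two]

/-- for `m > 1` and a natural number `s`: (i) for every `k < 2^{m-1}`,
`s·(2^{m-1}+k) ≡ s_{m-1} + s·k (mod 2)`; consequently (ii)
`Σ_{k=2^{m-1}}^{2^m-2} |(-1)^{s·(k+1)} - (-1)^{s·k}| = Σ_{k=0}^{2^{m-1}-2} |(-1)^{s·(k+1)} - (-1)^{s·k}|`. -/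
theorem stmt_4 (m : ℕ) (hm : 1 < m) (s : ℕ) :
    (∀ k < 2^(m-1), dot s (2^(m-1) + k) ≡ bit s (m-1) + dot s k [MOD 2]) ∧
    ∑ k ∈ Finset.Ico (2^(m-1)) (2^m - 1),
        |(-1:ℝ)^(dot s (k+1)) - (-1:ℝ)^(dot s k)| =
      ∑ k ∈ Finset.range (2^(m-1) - 1),
        |(-1:ℝ)^(dot s (k+1)) - (-1:ℝ)^(dot s k)| := by
  refine ⟨fun k hk => dot_two_pow_add_modEq s hk, ?_⟩
  obtain ⟨p, rfl⟩ : ∃ p, m = p + 1 := ⟨m - 1, by omega⟩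
  rw [Nat.add_sub_cancel, Finset.sum_Ico_eq_sum_range,
    show 2 ^ (p + 1) - 1 - 2 ^ p = 2 ^ p - 1 by rw [pow_succ]; omega]
  refine Finset.sum_congr rfl fun k hk => ?_
  rw [Finset.mem_range] at hk
  rw [add_assoc, neg_one_pow_dot_two_pow_add s (by omega),
    neg_one_pow_dot_two_pow_add s (by omega), ← mul_sub, abs_mul, abs_neg_one_pow, one_mul]
end

section
/- Let n ≥ 1 and let s, j < 2^n be natural numbers with binary digits s_i, j_i. Let g := g(s) with binary digits g_r, and set g_n := 0. Then s·j ≡ Σ_{r=0}^{n−1} j_{n−1−r} (g_r ⊕ g_{r+1}) (mod 2), where ⊕ denotes addition modulo 2. -/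
theorem bit_lt_two (s i : ℕ) : bit s i < 2 :=
  Bool.toNat_lt _

theorem bit_eq_zero_of_lt_two_pow {s i m : ℕ} (hs : s < 2 ^ m) (hi : m ≤ i) : bit s i = 0 := by
  rw [bit, Nat.testBit_lt_two_pow (hs.trans_le (Nat.pow_le_pow_right two_pos hi)), Bool.toNat_false]

theorem sum_mul_two_pow_lt {f : ℕ → ℕ} (hf : ∀ k, f k < 2) (n : ℕ) :
    ∑ k ∈ Finset.range n, f k * 2 ^ k < 2 ^ n := by
  induction n with
  | zero => simp
  | succ n ih =>
    rw [Finset.sum_range_succ, pow_succ]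
    have := Nat.mul_le_mul_right (2 ^ n) (Nat.le_of_lt_succ (hf n))
    omega

theorem bit_sum_mul_two_pow {f : ℕ → ℕ} (hf : ∀ k, f k < 2) {n r : ℕ} (hr : r < n) :
    bit (∑ k ∈ Finset.range n, f k * 2 ^ k) r = f r := by
  induction n with
  | zero => omega
  | succ n ih =>
    rw [Finset.sum_range_succ, add_comm, mul_comm, bit,
      Nat.testBit_two_pow_mul_add _ (sum_mul_two_pow_lt hf n)]
    split_ifs with h
    · exact ih h
    · obtain rfl : r = n := by omega
      have := hf r
      rw [Nat.sub_self]
      interval_cases f r <;> rfl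

theorem gbit_lt_two (n s k : ℕ) : gbit n s k < 2 :=
  Nat.mod_lt _ two_pos

theorem bit_gFun (n s r : ℕ) : bit (gFun n s) r = gbit n s r := by
  rcases lt_or_ge r n with hr | hr
  · exact bit_sum_mul_two_pow (gbit_lt_two n s) hr
  · rw [gFun, bit_eq_zero_of_lt_two_pow (sum_mul_two_pow_lt (gbit_lt_two n s) n) hr,
      gbit, Nat.sub_eq_zero_of_le hr]
    rfl

theorem gbit_add_gbit_succ_mod_two {n r : ℕ} (s : ℕ) (hr : r < n) :
    (gbit n s r + gbit n s (r + 1)) % 2 = bit s (n - 1 - r) := by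
  have h₁ : n - r = n - 1 - r + 1 := by omega
  have h₂ : n - (r + 1) = n - 1 - r := by omega
  have := bit_lt_two s (n - 1 - r)
  rw [gbit, gbit, h₁, h₂, Finset.sum_range_succ]
  omega

theorem sum_bit_mul_eq_of_lt_two_pow {s m m' : ℕ} (hs : s < 2 ^ m) (hs' : s < 2 ^ m') (f : ℕ → ℕ) :
    ∑ i ∈ Finset.range m, bit s i * f i = ∑ i ∈ Finset.range m', bit s i * f i := by
  wlog h : m ≤ m' generalizing m m'
  · exact (this hs' hs (le_of_not_ge h)).symm
  refine Finset.sum_subset (Finset.range_mono h) fun i _ hi ↦ ?_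
  rw [bit_eq_zero_of_lt_two_pow hs (by simpa using hi), zero_mul]

/-- for `n ≥ 1` and `s, j < 2^n`, with `g := g(s)` (whose binary digits
are `g_r`, and `g_n = 0` since `g < 2^n`),
`s·j ≡ Σ_{r=0}^{n-1} j_{n-1-r} (g_r ⊕ g_{r+1}) (mod 2)`. -/
theorem stmt_8 (n : ℕ) (hn : 1 ≤ n) (s j : ℕ) (hs : s < 2^n) (hj : j < 2^n) :
    dot s j ≡
      ∑ r ∈ Finset.range n,
        bit j (n-1-r) * ((bit (gFun n s) r + bit (gFun n s) (r+1)) % 2) [MOD 2] := by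
  have hsum : ∑ r ∈ Finset.range n,
      bit j (n-1-r) * ((bit (gFun n s) r + bit (gFun n s) (r+1)) % 2) =
      ∑ i ∈ Finset.range n, bit s i * bit j i := by
    rw [← Finset.sum_range_reflect (fun i ↦ bit s i * bit j i)]
    refine Finset.sum_congr rfl fun r hr ↦ ?_
    rw [bit_gFun, bit_gFun, gbit_add_gbit_succ_mod_two s (Finset.mem_range.mp hr), mul_comm]
  have hs' : s < 2 ^ (s + 1) := (Nat.lt_succ_self s).trans Nat.lt_two_pow_self
  rw [hsum, dot, sum_bit_mul_eq_of_lt_two_pow hs' hs]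
  exact Nat.mod_modEq _ _
end

section
/- Let n ≥ 0, N = 2^n, and let j, x < N be natural numbers. Then the sequency-ordered Walsh basis function W_j, sampled at the midpoint t_x = (2x+1)/(2N) of the x-th of N equal subintervals of [0,1], satisfies W_j(t_x) = (−1)^{e_n(x,j)}. In particular, the vector of midpoint samples of W_j equals the j-th column of the unnormalized sequency-ordered Walsh–Hadamard matrix of size N. -/
/-- The sequency-ordered Walsh basis functions: `W_0(t) = 1` on `[0,1]` and `0`
elsewhere; `W_{2k}(t) = W_k(2t) + (-1)^k W_k(2t-1)` (for `2k ≥ 2`) and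
`W_{2k+1}(t) = W_k(2t) - (-1)^k W_k(2t-1)`; each `W_m` with `m ≥ 1` vanishes
outside `[0,1]` since both `W_k(2t)` and `W_k(2t-1)` do. -/
noncomputable def W : ℕ → ℝ → ℝ
  | 0, t => if 0 ≤ t ∧ t ≤ 1 then 1 else 0
  | (m+1), t =>
      if (m+1) % 2 = 0 then
        W ((m+1)/2) (2*t) + (-1)^((m+1)/2) * W ((m+1)/2) (2*t - 1)
      else
        W ((m+1)/2) (2*t) - (-1)^((m+1)/2) * W ((m+1)/2) (2*t - 1)
  decreasing_by all_goals exact Nat.div_lt_self (Nat.succ_pos m) (by norm_num)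

theorem W_zero (t : ℝ) : W 0 t = if 0 ≤ t ∧ t ≤ 1 then 1 else 0 := by
  rw [W]

/-- The two cases of the recursion for `W` in a single formula. -/
theorem W_eq_of_ne_zero {j : ℕ} (hj : j ≠ 0) (t : ℝ) :
    W j t = W (j / 2) (2 * t) + (-1) ^ (j + j / 2) * W (j / 2) (2 * t - 1) := by
  obtain ⟨m, rfl⟩ := Nat.exists_eq_succ_of_ne_zero hj
  rw [Nat.succ_eq_add_one, W, pow_add]
  split_ifs with h
  · rw [(Nat.even_iff.mpr h).neg_one_pow, one_mul]
  · rw [(Nat.not_even_iff_odd.mp (mt Nat.even_iff.mp h)).neg_one_pow]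
    ring

theorem W_eq_zero_of_notMem (j : ℕ) {t : ℝ} (ht : t < 0 ∨ 1 < t) : W j t = 0 := by
  induction j using Nat.strong_induction_on generalizing t with
  | _ j ih =>
    rcases eq_or_ne j 0 with rfl | hj
    · rw [W_zero, if_neg]
      rintro ⟨h0, h1⟩
      rcases ht with h | h <;> linarith
    · have hlt : j / 2 < j := by omega
      rw [W_eq_of_ne_zero hj, ih _ hlt, ih _ hlt, mul_zero, add_zero]
      · exact ht.imp (fun h => by linarith) (fun h => by linarith)
      · exact ht.imp (fun h => by linarith) (fun h => by linarith)

theorem bit_zero_right (j : ℕ) : bit j 0 = j % 2 := by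
  rw [bit, Nat.testBit_zero]
  rcases Nat.mod_two_eq_zero_or_one j with h | h <;> simp [h]

theorem bit_succ (j i : ℕ) : bit j (i + 1) = bit (j / 2) i := by
  rw [bit, bit, Nat.testBit_succ]

theorem bit_mod_two_pow {n i : ℕ} (x : ℕ) (hi : i < n) : bit (x % 2 ^ n) i = bit x i := by
  simp [bit, Nat.testBit_mod_two_pow, hi]

theorem bit_of_lt_two_pow {n x : ℕ} (hx : x < 2 ^ n) : bit x n = 0 := by
  simp [bit, Nat.testBit_lt_two_pow hx]

theorem bit_two_pow_add_s14 {n y : ℕ} (hy : y < 2 ^ n) : bit (2 ^ n + y) n = 1 := by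
  simp [bit, Nat.testBit_two_pow_add_eq, Nat.testBit_lt_two_pow hy]

theorem eSeq_zero_right (n x : ℕ) : eSeq n x 0 = 0 := by
  simp [eSeq, bit]

/-- Splitting off the most significant bit of `x` and the least significant bit of `j`. -/
theorem neg_one_pow_eSeq_succ (n x j : ℕ) :
    (-1 : ℝ) ^ eSeq (n + 1) x j =
      (-1) ^ (bit x n * (j + j / 2)) * (-1) ^ eSeq n (x % 2 ^ n) (j / 2) := by
  have hsum : ∑ r ∈ Finset.range n,
        bit x (n + 1 - 1 - (r + 1)) * ((bit j (r + 1) + bit j (r + 1 + 1)) % 2) =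
      ∑ r ∈ Finset.range n,
        bit (x % 2 ^ n) (n - 1 - r) * ((bit (j / 2) r + bit (j / 2) (r + 1)) % 2) := by
    refine Finset.sum_congr rfl fun r hr => ?_
    have hr' := Finset.mem_range.mp hr
    rw [bit_mod_two_pow x (by omega), bit_succ, bit_succ,
      show n + 1 - 1 - (r + 1) = n - 1 - r by omega]
  rw [eSeq, eSeq, ← neg_one_pow_eq_pow_mod_two, ← neg_one_pow_eq_pow_mod_two,
    Finset.sum_range_succ', hsum, pow_add, mul_comm, bit_succ, bit_zero_right,
    bit_zero_right, ← Nat.add_mod, Nat.add_sub_cancel, Nat.sub_zero, mul_comm (bit x n),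
    mul_comm (bit x n), pow_mul, pow_mul, ← neg_one_pow_eq_pow_mod_two]

/-- for `n ≥ 0`, `N = 2^n` and `j, x < N`, the sequency-ordered Walsh
basis function `W_j`, sampled at the midpoint `t_x = (2x+1)/(2N)` of the `x`-th of
`N` equal subintervals of `[0,1]`, satisfies `W_j(t_x) = (-1)^{e_n(x,j)}`; i.e. the
midpoint samples of `W_j` form the `j`-th column of the unnormalized
sequency-ordered Walsh–Hadamard matrix of size `N`. -/
theorem stmt_14 (n j x : ℕ) (hj : j < 2^n) (hx : x < 2^n) :
    W j ((2 * (x : ℝ) + 1) / (2 * 2^n)) = (-1:ℝ)^(eSeq n x j) := by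
  induction n generalizing j x with
  | zero =>
    obtain rfl : j = 0 := by simpa using hj
    obtain rfl : x = 0 := by simpa using hx
    norm_num [W_zero, eSeq_zero_right]
  | succ n ih =>
    rcases eq_or_ne j 0 with rfl | hj0
    · have hx' : (x : ℝ) + 1 ≤ 2 ^ (n + 1) := by exact_mod_cast hx
      have hle : (2 * (x : ℝ) + 1) / (2 * 2 ^ (n + 1)) ≤ 1 := by
        rw [div_le_one (by positivity)]
        linarith
      rw [W_zero, if_pos ⟨by positivity, hle⟩, eSeq_zero_right, pow_zero]
    have hk : j / 2 < 2 ^ n := by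
      rw [pow_succ] at hj
      omega
    rw [W_eq_of_ne_zero hj0, neg_one_pow_eSeq_succ]
    rcases lt_or_ge x (2 ^ n) with hxn | hxn
    · have hx' : (x : ℝ) + 1 ≤ 2 ^ n := by exact_mod_cast hxn
      have ht : 2 * ((2 * (x : ℝ) + 1) / (2 * 2 ^ (n + 1))) = (2 * x + 1) / (2 * 2 ^ n) := by
        field_simp
        ring
      have hlt : (2 * (x : ℝ) + 1) / (2 * 2 ^ n) < 1 := by
        rw [div_lt_one (by positivity)]
        linarith
      rw [ht, ih _ _ hk hxn, W_eq_zero_of_notMem _ (Or.inl (by linarith)),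
        bit_of_lt_two_pow hxn, Nat.mod_eq_of_lt hxn]
      simp
    · obtain ⟨y, rfl⟩ := Nat.exists_eq_add_of_le hxn
      have hy : y < 2 ^ n := by
        rw [pow_succ] at hx
        omega
      have ht : 2 * ((2 * ((2 ^ n + y : ℕ) : ℝ) + 1) / (2 * 2 ^ (n + 1))) =
          (2 * y + 1) / (2 * 2 ^ n) + 1 := by
        push_cast
        field_simp
        ring
      have hpos : 0 < (2 * (y : ℝ) + 1) / (2 * 2 ^ n) := by positivity
      rw [ht, add_sub_cancel_right, ih _ _ hk hy,
        W_eq_zero_of_notMem _ (Or.inr (by linarith)), bit_two_pow_add_s14 hy,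
        Nat.add_mod_left, Nat.mod_eq_of_lt hy, one_mul, zero_add]
end
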